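/- Let H be a real Hilbert space and p ≥ 0. Then for all x, y ∈ H, ⟨‖x‖^p·x − ‖y‖^p·y, x − y⟩ ≥ 2^{-p}·‖x − y‖^{p+2}. -/

import Mathlib

theorem inner_norm_pow_smul_sub_ge {H : Type*} [NormedAddCommGroup H]
    [InnerProductSpace ℝ H] (p : ℝ) (hp : 0 ≤ p) (x y : H) :
    @inner ℝ H _ ((‖x‖ ^ p) • x - (‖y‖ ^ p) • y) (x - y) ≥
      2 ^ (-p) * ‖x - y‖ ^ (p + 2) := by
  have hd2 := norm_sub_sq_real x y
  have hin : @inner ℝ H _ ((‖x‖ ^ p) • x - (‖y‖ ^ p) • y) (x - y) =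
      ‖x‖ ^ p * ‖x‖ ^ 2 + ‖y‖ ^ p * ‖y‖ ^ 2
        - (‖x‖ ^ p + ‖y‖ ^ p) * @inner ℝ H _ x y := by
    simp only [inner_sub_left, inner_sub_right, real_inner_smul_left,
      real_inner_self_eq_norm_sq, real_inner_comm x y]
    ring
  have hdS : ‖x - y‖ ≤ ‖x‖ + ‖y‖ := norm_sub_le x y
  have ha := norm_nonneg x
  have hb := norm_nonneg y
  have hd := norm_nonneg (x - y)
  rw [hin]
  generalize @inner ℝ H _ x y = c at *
  generalize ‖x - y‖ = d at *
  generalize ‖x‖ = a at *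
  generalize ‖y‖ = b at *
  have hpow : (2 : ℝ) ^ (-p) * d ^ (p + 2) = (d / 2) ^ p * d ^ 2 := by
    rw [Real.rpow_add_of_nonneg hd hp (by norm_num), Real.div_rpow hd (by norm_num),
      Real.rpow_neg (by norm_num), Real.rpow_two]
    ring
  have hmono : (d / 2) ^ p ≤ ((a + b) / 2) ^ p :=
    Real.rpow_le_rpow (by positivity) (by linarith) hp
  have hK : 0 ≤ (a ^ p - b ^ p) * (a - b) := by
    rcases le_total a b with h | h
    · have := Real.rpow_le_rpow ha h hp
      exact mul_nonneg_of_nonpos_of_nonpos (by linarith) (by linarith)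
    · have := Real.rpow_le_rpow hb h hp
      exact mul_nonneg (by linarith) (by linarith)
  have hM : ((a + b) / 2) ^ p * (a + b) ≤ a ^ p * a + b ^ p * b := by
    have h := (convexOn_rpow (p := p + 1) (by linarith)).2 (Set.mem_Ici.2 ha) (Set.mem_Ici.2 hb)
      (show (0 : ℝ) ≤ 1 / 2 by norm_num) (show (0 : ℝ) ≤ 1 / 2 by norm_num) (by norm_num)
    simp only [smul_eq_mul] at h
    rw [show 1 / 2 * a + 1 / 2 * b = (a + b) / 2 by ring,
      Real.rpow_add_of_nonneg (by positivity) hp (by norm_num),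
      Real.rpow_add_of_nonneg ha hp (by norm_num),
      Real.rpow_add_of_nonneg hb hp (by norm_num)] at h
    simp only [Real.rpow_one] at h
    linarith
  rw [hpow]
  have h1 : (d / 2) ^ p * d ^ 2 ≤ ((a + b) / 2) ^ p * d ^ 2 :=
    mul_le_mul_of_nonneg_right hmono (sq_nonneg d)
  refine ge_iff_le.2 (h1.trans ?_)
  have hc : c = (a ^ 2 + b ^ 2 - d ^ 2) / 2 := by linarith
  subst hc
  generalize a ^ p = A at *
  generalize b ^ p = B at *
  generalize ((a + b) / 2) ^ p = M at *
  rcases (add_nonneg ha hb).eq_or_lt with h0 | hS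
  · have : a = 0 := by linarith
    have : b = 0 := by linarith
    have : d = 0 := by linarith
    subst_vars
    simp
  · have hdd : d ^ 2 ≤ (a + b) ^ 2 := pow_le_pow_left₀ hd hdS 2
    have e1 := mul_le_mul_of_nonneg_left hdd hK
    have e2 := mul_le_mul_of_nonneg_right hM (sq_nonneg d)
    refine le_of_mul_le_mul_right ?_ hS
    linarith
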